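/- The Khinchin–Lévy theorem: for Lebesgue-almost every real number x, the denominators q_n(x) of the n-th convergents p_n(x)/q_n(x) of the continued fraction expansion of x satisfy lim_{n→∞} (q_n(x))^{1/n} = e^{π²/(12 log 2)}, the Khinchin–Lévy constant L₀ ≈ 3.275822918721811. -/

import Mathlib

open Filter

/-- The Gauss map `y ↦ frac (1/y)` generating continued fraction expansions. -/
noncomputable def gaussMap (y : ℝ) : ℝ := Int.fract y⁻¹

/-- The `(i+1)`-st partial quotient `a_{i+1}(x)` of the continued fraction
expansion `x = [a₀; a₁, a₂, …]`:  `a_{i+1}(x) = ⌊1 / (gaussMap^[i] (frac x))⌋`. -/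
noncomputable def partialQuotient (x : ℝ) (i : ℕ) : ℤ :=
  ⌊(gaussMap^[i] (Int.fract x))⁻¹⌋

/-- The denominator `q_n(x)` of the `n`-th convergent `p_n/q_n = [a₀; a₁, …, a_n]`
of the continued fraction of `x`, defined by the recursion
`q₀ = 1`, `q₁ = a₁`, `q_n = a_n q_{n-1} + q_{n-2}`. -/
noncomputable def convDenom (x : ℝ) : ℕ → ℤ
  | 0 => 1
  | 1 => partialQuotient x 0
  | (n + 2) => partialQuotient x (n + 1) * convDenom x (n + 1) + convDenom x n

section Birkhoff
open MeasureTheory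

variable {α : Type*}

/-- `birkhoffMax T g n x` is the maximum of the Birkhoff sums of `g` along the first `k` points of
the orbit of `x`, over all `k ≤ n`. -/
noncomputable def birkhoffMax (T : α → α) (g : α → ℝ) : ℕ → α → ℝ
  | 0, _ => 0
  | n + 1, x => max 0 (g x + birkhoffMax T g n (T x))

theorem birkhoffMax_nonneg (T : α → α) (g : α → ℝ) (n : ℕ) (x : α) : 0 ≤ birkhoffMax T g n x := by
  cases n with
  | zero => exact le_rfl
  | succ n => exact le_max_left _ _

theorem birkhoffMax_le_succ (T : α → α) (g : α → ℝ) (n : ℕ) (x : α) :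
    birkhoffMax T g n x ≤ birkhoffMax T g (n + 1) x := by
  induction n generalizing x with
  | zero => exact birkhoffMax_nonneg T g 1 x
  | succ n ih => exact max_le_max_left _ (by linarith [ih (T x)])

theorem monotone_birkhoffMax (T : α → α) (g : α → ℝ) (x : α) :
    Monotone fun n => birkhoffMax T g n x :=
  monotone_nat_of_le_succ fun n => birkhoffMax_le_succ T g n x

theorem birkhoffSum_le_birkhoffMax (T : α → α) (g : α → ℝ) (n : ℕ) (x : α) :
    birkhoffSum T g n x ≤ birkhoffMax T g n x := by
  induction n generalizing x with
  | zero => simp [birkhoffMax]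
  | succ n ih =>
    rw [birkhoffSum_succ']
    exact le_max_of_le_right (by linarith [ih (T x)])

theorem bddAbove_birkhoffSum_comp_iff (T : α → α) (g : α → ℝ) (x : α) :
    BddAbove (Set.range fun n => birkhoffSum T g n (T x)) ↔
      BddAbove (Set.range fun n => birkhoffSum T g n x) := by
  constructor
  · rintro ⟨C, hC⟩
    refine ⟨max 0 (g x + C), ?_⟩
    rintro _ ⟨n, rfl⟩
    cases n with
    | zero => simp
    | succ n =>
      have := hC ⟨n, rfl⟩
      simp only [birkhoffSum_succ'] at *
      exact le_max_of_le_right (by linarith)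
  · rintro ⟨C, hC⟩
    refine ⟨C - g x, ?_⟩
    rintro _ ⟨n, rfl⟩
    have := hC ⟨n + 1, rfl⟩
    simp only [birkhoffSum_succ'] at *
    linarith

variable [MeasurableSpace α] {μ : Measure α} {T : α → α} {g : α → ℝ}

theorem integrable_birkhoffMax (hT : MeasurePreserving T μ μ) (hg : Integrable g μ) (n : ℕ) :
    Integrable (birkhoffMax T g n) μ := by
  induction n with
  | zero => exact integrable_zero _ _ _
  | succ n ih => exact (integrable_zero _ _ _).sup (hg.add (hT.integrable_comp_of_integrable ih))

theorem measurable_birkhoffSum (hT : Measurable T) (hg : Measurable g) (n : ℕ) :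
    Measurable (birkhoffSum T g n) :=
  Finset.measurable_sum _ fun k _ => hg.comp (hT.iterate k)

/-- If the Birkhoff sums are almost everywhere unbounded above, the integral is nonnegative. -/
theorem integral_nonneg_of_not_bddAbove_birkhoffSum (hT : MeasurePreserving T μ μ)
    (hg : Integrable g μ)
    (h : ∀ᵐ x ∂μ, ¬ BddAbove (Set.range fun n => birkhoffSum T g n x)) : 0 ≤ ∫ x, g x ∂μ := by
  have hlim : Tendsto (fun n => ∫ x, (birkhoffMax T g (n + 1) x - birkhoffMax T g n (T x)) ∂μ)
      atTop (nhds (∫ x, g x ∂μ)) := by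
    refine tendsto_integral_of_dominated_convergence (fun x => |g x|) (fun n => ?_) hg.abs
      (fun n => Eventually.of_forall fun x => ?_) ?_
    · exact ((integrable_birkhoffMax hT hg _).sub
        (hT.integrable_comp_of_integrable (integrable_birkhoffMax hT hg n))).aestronglyMeasurable
    · have h0 := birkhoffMax_nonneg T g n (T x)
      rw [Real.norm_eq_abs, birkhoffMax]
      rcases max_cases 0 (g x + birkhoffMax T g n (T x)) with h | h <;>
      · rw [h.1]
        rcases abs_cases (g x) with h' | h' <;> rw [abs_le] <;> constructor <;> linarith
    · filter_upwards [h] with x hx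
      rw [← bddAbove_birkhoffSum_comp_iff, not_bddAbove_iff] at hx
      obtain ⟨_, ⟨N, rfl⟩, hN⟩ := hx (-g x)
      refine tendsto_const_nhds.congr' ?_
      filter_upwards [eventually_ge_atTop N] with n hn
      have h1 := birkhoffSum_le_birkhoffMax T g N (T x)
      have h2 := monotone_birkhoffMax T g (T x) hn
      simp only at h2 hN
      rw [birkhoffMax, max_eq_right (by linarith)]
      ring
  refine ge_of_tendsto' hlim fun n => ?_
  have hn := integrable_birkhoffMax hT hg n
  have hnT : Integrable (fun x => birkhoffMax T g n (T x)) μ := hT.integrable_comp_of_integrable hn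
  rw [integral_sub (integrable_birkhoffMax hT hg _) hnT,
    show ∫ x, birkhoffMax T g n (T x) ∂μ = ∫ x, birkhoffMax T g n x ∂μ by
      conv_rhs => rw [← hT.map_eq]
      rw [integral_map hT.aemeasurable (by rw [hT.map_eq]; exact hn.aestronglyMeasurable)],
    sub_nonneg]
  exact integral_mono hn (integrable_birkhoffMax hT hg _) (birkhoffMax_le_succ T g n)

theorem ae_bddAbove_birkhoffSum_of_integral_neg (hT : Ergodic T μ) (hg : Integrable g μ)
    (hgm : Measurable g) (h : ∫ x, g x ∂μ < 0) :
    ∀ᵐ x ∂μ, BddAbove (Set.range fun n => birkhoffSum T g n x) := by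
  have hm : MeasurableSet {x | BddAbove (Set.range fun n => birkhoffSum T g n x)} :=
    measurableSet_bddAbove_range fun n => measurable_birkhoffSum hT.measurable hgm n
  have hinv : T ⁻¹' {x | BddAbove (Set.range fun n => birkhoffSum T g n x)} =
      {x | BddAbove (Set.range fun n => birkhoffSum T g n x)} :=
    Set.ext fun x => bddAbove_birkhoffSum_comp_iff T g x
  rcases hT.ae_mem_or_ae_notMem hm hinv with h' | h'
  · exact h'
  · exact absurd (integral_nonneg_of_not_bddAbove_birkhoffSum hT.toMeasurePreserving hg h')
      (not_le.2 h)

theorem ae_eventually_birkhoffSum_lt [IsProbabilityMeasure μ] (hT : Ergodic T μ)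
    (hg : Integrable g μ) (hgm : Measurable g) {c : ℝ} (hc : ∫ x, g x ∂μ < c) :
    ∀ᵐ x ∂μ, ∀ᶠ n : ℕ in atTop, birkhoffSum T g n x / n < c := by
  obtain ⟨d, hd, hdc⟩ := exists_between hc
  have := ae_bddAbove_birkhoffSum_of_integral_neg hT (hg.sub (integrable_const d))
    (hgm.sub measurable_const) (by simp [integral_sub hg (integrable_const d), hd])
  filter_upwards [this] with x ⟨C, hC⟩
  have hlim : Tendsto (fun n : ℕ => C / (n : ℝ)) atTop (nhds 0) :=
    tendsto_const_div_atTop_nhds_zero_nat C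
  filter_upwards [hlim.eventually_lt_const (sub_pos.2 hdc), eventually_gt_atTop 0] with n hn hn0
  have h1 : birkhoffSum T (g - fun _ => d) n x ≤ C := hC ⟨n, rfl⟩
  have h2 : birkhoffSum T (g - fun _ => d) n x = birkhoffSum T g n x - n * d := by
    simp [birkhoffSum, Finset.sum_sub_distrib]
  have hn0' : (0 : ℝ) < n := by exact_mod_cast hn0
  rw [div_lt_iff₀ hn0'] at hn ⊢
  linarith

/-- **Birkhoff's pointwise ergodic theorem** for ergodic maps on a probability space. -/
theorem Ergodic.ae_tendsto_birkhoffSum_div [IsProbabilityMeasure μ] (hT : Ergodic T μ)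
    (hg : Integrable g μ) (hgm : Measurable g) :
    ∀ᵐ x ∂μ, Tendsto (fun n : ℕ => birkhoffSum T g n x / n) atTop (nhds (∫ x, g x ∂μ)) := by
  have hub : ∀ᵐ x ∂μ, ∀ k : ℕ, ∀ᶠ n : ℕ in atTop,
      birkhoffSum T g n x / n < ∫ x, g x ∂μ + 1 / ((k : ℝ) + 1) :=
    ae_all_iff.2 fun k => ae_eventually_birkhoffSum_lt hT hg hgm
      (lt_add_of_pos_right _ Nat.one_div_pos_of_nat)
  have hlb : ∀ᵐ x ∂μ, ∀ k : ℕ, ∀ᶠ n : ℕ in atTop,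
      birkhoffSum T (-g) n x / n < -∫ x, g x ∂μ + 1 / ((k : ℝ) + 1) :=
    ae_all_iff.2 fun k => ae_eventually_birkhoffSum_lt hT hg.neg hgm.neg
      (by simpa [integral_neg] using (Nat.one_div_pos_of_nat (α := ℝ) (n := k)))
  filter_upwards [hub, hlb] with x hu hl
  rw [Metric.tendsto_nhds]
  intro ε hε
  obtain ⟨k, hk⟩ := exists_nat_one_div_lt hε
  filter_upwards [hu k, hl k] with n h1 h2
  have h3 : birkhoffSum T (-g) n x = -birkhoffSum T g n x := by simp [birkhoffSum]
  rw [h3, neg_div] at h2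
  rw [Real.dist_eq, abs_lt]
  constructor <;> linarith

end Birkhoff

section GaussMeasure
open MeasureTheory Set

theorem measurable_gaussMap : Measurable gaussMap := measurable_fract.comp measurable_inv

/-- The Gauss measure, with density `1 / ((1 + x) log 2)` on the unit interval. -/
noncomputable def gaussMeasure : Measure ℝ :=
  (volume.restrict (Ico 0 1)).withDensity fun x => ENNReal.ofReal (((1 + x) * Real.log 2)⁻¹)

/-- The weight of the `k`-th inverse branch in the transfer operator of the Gauss map with respect
to the Gauss measure. -/
noncomputable def gaussWeight (k : ℕ) (y : ℝ) : ℝ := (1 + y) / ((k + 1 + y) * (k + 2 + y))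

/-- The transfer operator of the Gauss map with respect to the Gauss measure. -/
noncomputable def gaussTransfer (H : ℝ → ℝ) (y : ℝ) : ℝ :=
  ∑' k : ℕ, gaussWeight k y * H ((k + 1 + y)⁻¹)

theorem gaussWeight_nonneg (k : ℕ) {y : ℝ} (hy : 0 ≤ y) : 0 ≤ gaussWeight k y := by
  unfold gaussWeight; positivity

theorem sum_gaussWeight (n : ℕ) {y : ℝ} (hy : 0 ≤ y) :
    ∑ k ∈ Finset.range n, gaussWeight k y = n / (n + 1 + y) := by
  induction n with
  | zero => simp
  | succ n ih =>
    rw [Finset.sum_range_succ, ih, gaussWeight]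
    push_cast
    have : (n : ℝ) + 1 + 1 + y ≠ 0 := by positivity
    field_simp
    ring

theorem hasSum_gaussWeight {y : ℝ} (hy : 0 ≤ y) : HasSum (fun k => gaussWeight k y) 1 := by
  rw [hasSum_iff_tendsto_nat_of_nonneg fun k => gaussWeight_nonneg k hy]
  simp_rw [fun n => sum_gaussWeight n hy]
  simpa [add_assoc] using tendsto_natCast_div_add_atTop (1 + y)

/-- The inverse branches of the Gauss map map the unit interval into itself. -/
theorem inv_add_mem_Icc (k : ℕ) {y : ℝ} (hy : 0 ≤ y) : ((k : ℝ) + 1 + y)⁻¹ ∈ Icc (0 : ℝ) 1 :=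
  ⟨by positivity, inv_le_one_of_one_le₀ (by linarith [k.cast_nonneg (α := ℝ)])⟩

theorem gaussMap_inv_add (k : ℕ) {y : ℝ} (hy : y ∈ Ico (0 : ℝ) 1) :
    gaussMap ((k + 1 + y)⁻¹) = y := by
  rw [gaussMap, inv_inv, show (k : ℝ) + 1 + y = ((k + 1 : ℕ) : ℝ) + y by push_cast; ring,
    Int.fract_natCast_add, Int.fract_eq_self.2 hy]

theorem iUnion_image_inv_add :
    ⋃ k : ℕ, (fun y : ℝ => ((k : ℝ) + 1 + y)⁻¹) '' Ico 0 1 = Ioc 0 1 := by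
  ext x
  simp only [mem_iUnion, mem_image]
  constructor
  · rintro ⟨k, y, hy, rfl⟩
    have := hy.1
    exact ⟨by positivity, (inv_add_mem_Icc k hy.1).2⟩
  · rintro ⟨h0, h1⟩
    have h2 : 1 ≤ x⁻¹ := (one_le_inv₀ h0).2 h1
    have h3 : 1 ≤ ⌊x⁻¹⌋₊ := Nat.le_floor (by simpa using h2)
    refine ⟨⌊x⁻¹⌋₊ - 1, x⁻¹ - ⌊x⁻¹⌋₊, ⟨?_, ?_⟩, ?_⟩
    · linarith [Nat.floor_le (zero_le_one.trans h2)]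
    · linarith [Nat.lt_floor_add_one x⁻¹]
    · rw [Nat.cast_sub h3]
      simp

theorem pairwise_disjoint_image_inv_add :
    Pairwise (Function.onFun Disjoint
      fun k : ℕ => (fun y : ℝ => ((k : ℝ) + 1 + y)⁻¹) '' Ico 0 1) := by
  intro j k hjk
  refine Set.disjoint_left.2 ?_
  rintro _ ⟨y, hy, rfl⟩ ⟨z, hz, h⟩
  have hyz : z = y := by rw [← gaussMap_inv_add k hz, ← gaussMap_inv_add j hy]; exact congrArg _ h
  subst hyz
  have := inv_injective h
  apply hjk
  have h' : (j : ℝ) = k := by linarith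
  exact_mod_cast h'

theorem hasDerivAt_inv_add (k : ℕ) {y : ℝ} (hy : 0 ≤ y) :
    HasDerivAt (fun y : ℝ => ((k : ℝ) + 1 + y)⁻¹) (-((k + 1 + y) ^ 2)⁻¹) y := by
  have h : (k : ℝ) + 1 + y ≠ 0 := by positivity
  simpa [neg_div] using ((hasDerivAt_id y).const_add ((k : ℝ) + 1)).fun_inv h

theorem injective_inv_add (k : ℕ) : Function.Injective fun y : ℝ => ((k : ℝ) + 1 + y)⁻¹ :=
  inv_injective.comp (add_right_injective _)

theorem setLIntegral_eq_tsum_inv_add (F : ℝ → ENNReal) :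
    ∫⁻ x in Ico 0 1, F x =
      ∑' k : ℕ, ∫⁻ y in Ico (0 : ℝ) 1,
        ENNReal.ofReal (((k + 1 + y) ^ 2)⁻¹) * F ((k + 1 + y)⁻¹) := by
  have hd : ∀ k : ℕ, ∀ x ∈ Ico (0 : ℝ) 1, HasDerivWithinAt (fun y : ℝ => ((k : ℝ) + 1 + y)⁻¹)
      (-((k + 1 + x) ^ 2)⁻¹) (Ico 0 1) x :=
    fun k x hx => (hasDerivAt_inv_add k hx.1).hasDerivWithinAt
  have hIoc : ∫⁻ x in Ico 0 1, F x = ∫⁻ x in Ioc 0 1, F x := by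
    rw [← restrict_Ioo_eq_restrict_Ico, restrict_Ioo_eq_restrict_Ioc]
  rw [hIoc, ← iUnion_image_inv_add, lintegral_iUnion _ pairwise_disjoint_image_inv_add]
  · refine tsum_congr fun k => ?_
    rw [lintegral_image_eq_lintegral_abs_deriv_mul measurableSet_Ico (hd k)
      (injective_inv_add k).injOn]
    simp
  · intro k
    exact measurable_image_of_fderivWithin measurableSet_Ico
      (fun x hx => (hd k x hx).hasFDerivWithinAt) (injective_inv_add k).injOn

theorem measurable_gaussDensity :
    Measurable fun x : ℝ => ENNReal.ofReal (((1 + x) * Real.log 2)⁻¹) := by fun_prop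

theorem lintegral_gaussMeasure {F : ℝ → ENNReal} (hF : Measurable F) :
    ∫⁻ x, F x ∂gaussMeasure =
      ∫⁻ x in Ico 0 1, ENNReal.ofReal (((1 + x) * Real.log 2)⁻¹) * F x := by
  rw [gaussMeasure, lintegral_withDensity_eq_lintegral_mul _ measurable_gaussDensity hF]
  rfl

theorem lintegral_comp_gaussMap_mul {G H : ℝ → ENNReal} (hG : Measurable G) (hH : Measurable H) :
    ∫⁻ x, G (gaussMap x) * H x ∂gaussMeasure =
      ∫⁻ y, G y * ∑' k : ℕ, ENNReal.ofReal (gaussWeight k y) * H ((k + 1 + y)⁻¹)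
        ∂gaussMeasure := by
  have hw : ∀ k : ℕ, Measurable fun y : ℝ =>
      ENNReal.ofReal (gaussWeight k y) * H ((k + 1 + y)⁻¹) := fun k => by
    unfold gaussWeight; fun_prop
  rw [lintegral_gaussMeasure (F := fun x => G (gaussMap x) * H x)
      ((hG.comp measurable_gaussMap).mul hH),
    lintegral_gaussMeasure (F := fun y => G y * ∑' k : ℕ, _) (hG.mul (.tsum hw)),
    setLIntegral_eq_tsum_inv_add]
  simp_rw [← ENNReal.tsum_mul_left]
  rw [lintegral_tsum]
  · refine tsum_congr fun k => setLIntegral_congr_fun measurableSet_Ico fun y hy => ?_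
    have hlog : 0 < Real.log 2 := Real.log_pos one_lt_two
    have hy0 := hy.1
    simp only [gaussMap_inv_add k hy]
    have key : ENNReal.ofReal (((k + 1 + y) ^ 2)⁻¹) *
        ENNReal.ofReal (((1 + (k + 1 + y)⁻¹) * Real.log 2)⁻¹) =
        ENNReal.ofReal (((1 + y) * Real.log 2)⁻¹) * ENNReal.ofReal (gaussWeight k y) := by
      rw [← ENNReal.ofReal_mul (by positivity), ← ENNReal.ofReal_mul (by positivity), gaussWeight]
      congr 1
      have : (k : ℝ) + 1 + y ≠ 0 := by positivity
      field_simp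
      ring
    rw [← mul_assoc, key]
    ring
  · exact fun k => (measurable_gaussDensity.mul (hG.mul (hw k))).aemeasurable

end GaussMeasure

section GaussErgodic
open MeasureTheory Set

theorem ae_gaussMeasure_mem_Ico : ∀ᵐ x ∂gaussMeasure, x ∈ Ico (0 : ℝ) 1 :=
  (withDensity_absolutelyContinuous _ _).ae_le (ae_restrict_mem measurableSet_Ico)

theorem intervalIntegral_gaussDensity : ∫ x in (0 : ℝ)..1, ((1 + x) * Real.log 2)⁻¹ = 1 := by
  simp_rw [mul_inv]
  rw [intervalIntegral.integral_mul_const,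
    intervalIntegral.integral_comp_add_left (fun x => x⁻¹), integral_inv_of_pos] <;> norm_num

theorem intervalIntegrable_gaussDensity :
    IntervalIntegrable (fun x : ℝ => ((1 + x) * Real.log 2)⁻¹) volume 0 1 := by
  by_contra h
  exact zero_ne_one ((intervalIntegral.integral_undef h).symm.trans intervalIntegral_gaussDensity)

instance isProbabilityMeasure_gaussMeasure : IsProbabilityMeasure gaussMeasure := by
  refine ⟨?_⟩
  have h0 : 0 ≤ᵐ[volume.restrict (Ico (0 : ℝ) 1)] fun x => ((1 + x) * Real.log 2)⁻¹ := by
    filter_upwards [ae_restrict_mem measurableSet_Ico] with x hx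
    have := hx.1
    have := Real.log_pos one_lt_two
    simp only [Pi.zero_apply]
    positivity
  have hi : IntegrableOn (fun x : ℝ => ((1 + x) * Real.log 2)⁻¹) (Ico 0 1) := by
    rw [← intervalIntegrable_iff_integrableOn_Ico_of_le zero_le_one]
    exact intervalIntegrable_gaussDensity
  rw [gaussMeasure, withDensity_apply _ MeasurableSet.univ, Measure.restrict_univ,
    ← ofReal_integral_eq_lintegral_ofReal hi h0, ← restrict_Ioo_eq_restrict_Ico,
    restrict_Ioo_eq_restrict_Ioc, ← intervalIntegral.integral_of_le zero_le_one,
    intervalIntegral_gaussDensity, ENNReal.ofReal_one]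

theorem measurePreserving_gaussMap : MeasurePreserving gaussMap gaussMeasure gaussMeasure := by
  refine ⟨measurable_gaussMap, Measure.ext fun B hB => ?_⟩
  have h := lintegral_comp_gaussMap_mul (G := B.indicator 1) (H := 1)
    (measurable_one.indicator hB) measurable_one
  rw [Measure.map_apply measurable_gaussMap hB,
    ← lintegral_indicator_one (measurable_gaussMap hB), ← lintegral_indicator_one hB]
  simp only [Pi.one_apply, mul_one] at h
  refine Eq.trans h (lintegral_congr_ae ?_)
  filter_upwards [ae_gaussMeasure_mem_Ico] with y hy
  have hs := hasSum_gaussWeight hy.1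
  rw [← ENNReal.ofReal_tsum_of_nonneg (fun k => gaussWeight_nonneg k hy.1) hs.summable,
    hs.tsum_eq, ENNReal.ofReal_one, mul_one]

variable {H : ℝ → ℝ}

theorem summable_gaussTransfer (hH : Monotone H) (h0 : H 0 = 0) {y z : ℝ} (hy : 0 ≤ y)
    (hz : 0 ≤ z) : Summable fun k : ℕ => gaussWeight k y * H ((k + 1 + z)⁻¹) := by
  refine Summable.of_nonneg_of_le (fun k => mul_nonneg (gaussWeight_nonneg k hy) ?_) (fun k => ?_)
    ((hasSum_gaussWeight hy).summable.mul_right (H 1))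
  · exact h0 ▸ hH (inv_add_mem_Icc k hz).1
  · exact mul_le_mul_of_nonneg_left (hH (inv_add_mem_Icc k hz).2) (gaussWeight_nonneg k hy)

theorem gaussTransfer_nonneg (hH : Monotone H) (h0 : H 0 = 0) {y : ℝ} (hy : 0 ≤ y) :
    0 ≤ gaussTransfer H y :=
  tsum_nonneg fun k => mul_nonneg (gaussWeight_nonneg k hy) (h0 ▸ hH (inv_add_mem_Icc k hy).1)

/-- Abel summation: a sum with nonnegative partial sums remains nonnegative when weighted by an
antitone nonnegative sequence. -/
theorem Finset.sum_range_mul_nonneg_of_antitone {d b : ℕ → ℝ} (hb : Antitone b) (hb0 : ∀ n, 0 ≤ b n)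
    (hd : ∀ n, 0 ≤ ∑ k ∈ Finset.range n, d k) (n : ℕ) :
    0 ≤ ∑ k ∈ Finset.range n, d k * b k := by
  suffices h : ∀ n, b n * ∑ k ∈ Finset.range n, d k ≤ ∑ k ∈ Finset.range n, d k * b k from
    (mul_nonneg (hb0 n) (hd n)).trans (h n)
  intro n
  induction n with
  | zero => simp
  | succ n ih =>
    have h1 := mul_le_mul_of_nonneg_right (hb n.le_succ) (hd (n + 1))
    rw [Finset.sum_range_succ] at h1 ⊢
    rw [Finset.sum_range_succ]
    linarith

theorem antitoneOn_gaussTransfer (hH : Monotone H) (h0 : H 0 = 0) :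
    AntitoneOn (gaussTransfer H) (Ici 0) := by
  intro x hx y hy hxy
  rw [mem_Ici] at hx hy
  have h1 : gaussTransfer H y ≤ ∑' k : ℕ, gaussWeight k y * H ((k + 1 + x)⁻¹) :=
    (summable_gaussTransfer hH h0 hy hy).tsum_le_tsum
      (fun k => mul_le_mul_of_nonneg_left
        (hH (inv_anti₀ (by positivity) (by linarith))) (gaussWeight_nonneg k hy))
      (summable_gaussTransfer hH h0 hy hx)
  refine h1.trans ?_
  have hsx := summable_gaussTransfer hH h0 hx hx
  have hsy := summable_gaussTransfer hH h0 hy hx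
  rw [← sub_nonneg, gaussTransfer, ← hsx.tsum_sub hsy]
  refine ge_of_tendsto' (hsx.sub hsy).hasSum.tendsto_sum_nat fun n => ?_
  simp_rw [← sub_mul]
  refine Finset.sum_range_mul_nonneg_of_antitone (fun i j hij => hH ?_)
    (fun k => h0 ▸ hH (inv_add_mem_Icc k hx).1) (fun n => ?_) n
  · exact inv_anti₀ (by positivity) (by gcongr)
  · rw [Finset.sum_sub_distrib, sum_gaussWeight n hx, sum_gaussWeight n hy, sub_nonneg]
    gcongr

/-- The oscillation of a monotone function at least halves under the transfer operator. -/
theorem gaussTransfer_zero_sub_one_le (hH : Monotone H) (h0 : H 0 = 0) :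
    gaussTransfer H 0 - gaussTransfer H 1 ≤ H 1 / 2 := by
  have h1 := gaussTransfer_nonneg hH h0 zero_le_one
  have h2 : gaussTransfer H 0 = H 1 / 2 + gaussTransfer H 1 / 2 := by
    rw [gaussTransfer, (summable_gaussTransfer hH h0 le_rfl le_rfl).tsum_eq_zero_add, gaussTransfer,
      ← tsum_div_const]
    congr 1
    · simp [gaussWeight]; ring
    · refine tsum_congr fun k => ?_
      rw [gaussWeight, gaussWeight]
      push_cast
      rw [show (k : ℝ) + 1 + 1 + 0 = k + 1 + 1 by ring, show (k : ℝ) + 1 + 2 + 0 = k + 2 + 1 by ring,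
        show (k : ℝ) + 1 + 1 = k + 2 by ring]
      ring
  linarith

/-- The transfer operator, recentred and reflected so as to preserve the monotone functions
vanishing at `0`. -/
noncomputable def gaussStep (H : ℝ → ℝ) (y : ℝ) : ℝ :=
  gaussTransfer H 0 - gaussTransfer H (max 0 (min 1 y))

theorem monotone_gaussStep (hH : Monotone H) (h0 : H 0 = 0) : Monotone (gaussStep H) := by
  intro x y hxy
  exact sub_le_sub_left (antitoneOn_gaussTransfer hH h0 (mem_Ici.2 (le_max_left _ _))
    (mem_Ici.2 (le_max_left _ _)) (max_le_max_left _ (min_le_min_left _ hxy))) _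

theorem gaussStep_zero : gaussStep H 0 = 0 := by simp [gaussStep]

theorem gaussStep_one_le (hH : Monotone H) (h0 : H 0 = 0) : gaussStep H 1 ≤ H 1 / 2 := by
  simpa [gaussStep] using gaussTransfer_zero_sub_one_le hH h0

theorem ae_gaussMeasure_mem_Icc_of_monotone (hH : Monotone H) (h0 : H 0 = 0) :
    ∀ᵐ x ∂gaussMeasure, H x ∈ Icc 0 (H 1) := by
  filter_upwards [ae_gaussMeasure_mem_Ico] with x hx
  exact ⟨h0 ▸ hH hx.1, hH hx.2.le⟩

theorem integrable_gaussMeasure_of_monotone (hH : Monotone H) (h0 : H 0 = 0) :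
    Integrable H gaussMeasure :=
  .of_mem_Icc 0 (H 1) hH.measurable.aemeasurable (ae_gaussMeasure_mem_Icc_of_monotone hH h0)

theorem setIntegral_gaussStep (hH : Monotone H) (h0 : H 0 = 0) {A : Set ℝ} (hA : MeasurableSet A)
    (hinv : gaussMap ⁻¹' A = A) :
    ∫ x in A, gaussStep H x ∂gaussMeasure =
      gaussTransfer H 0 * gaussMeasure.real A - ∫ x in A, H x ∂gaussMeasure := by
  have hHae := ae_gaussMeasure_mem_Icc_of_monotone hH h0
  have hSi := integrable_gaussMeasure_of_monotone (monotone_gaussStep hH h0) gaussStep_zero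
  have hH' : ∫ x in A, H x ∂gaussMeasure =
      ∫ x in A, (gaussTransfer H 0 - gaussStep H x) ∂gaussMeasure := by
    rw [integral_eq_lintegral_of_nonneg_ae
        (ae_restrict_of_ae (hHae.mono fun x hx => hx.1)) hH.measurable.aestronglyMeasurable,
      integral_eq_lintegral_of_nonneg_ae (f := fun x => gaussTransfer H 0 - gaussStep H x)
        (ae_restrict_of_ae ?_) (((integrable_const _).sub hSi).restrict.aestronglyMeasurable)]
    · congr 1
      have key := lintegral_comp_gaussMap_mul (G := A.indicator 1)
        (H := fun x => ENNReal.ofReal (H x)) (measurable_one.indicator hA)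
        hH.measurable.ennreal_ofReal
      have hind : ∀ x, A.indicator (1 : ℝ → ENNReal) (gaussMap x) = A.indicator 1 x := fun x => by
        conv_rhs => rw [← hinv]
        rfl
      have hmul : ∀ (F : ℝ → ENNReal) (x : ℝ), A.indicator 1 x * F x = A.indicator F x :=
        fun F x => by by_cases hx : x ∈ A <;> simp [hx]
      simp_rw [hind, hmul (fun x => ENNReal.ofReal (H x))] at key
      rw [lintegral_indicator hA] at key
      rw [key, ← lintegral_indicator hA]
      refine lintegral_congr_ae ?_
      filter_upwards [ae_gaussMeasure_mem_Ico] with y hy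
      rw [hmul (fun y => ∑' k : ℕ,
        ENNReal.ofReal (gaussWeight k y) * ENNReal.ofReal (H ((k + 1 + y)⁻¹)))]
      by_cases hyA : y ∈ A
      · simp only [hyA, indicator_of_mem, gaussStep, sub_sub_cancel]
        rw [min_eq_right hy.2.le, max_eq_right hy.1, gaussTransfer, ENNReal.ofReal_tsum_of_nonneg
          (fun k => mul_nonneg (gaussWeight_nonneg k hy.1) (h0 ▸ hH (inv_add_mem_Icc k hy.1).1))
          (summable_gaussTransfer hH h0 hy.1 hy.1)]
        exact tsum_congr fun k => (ENNReal.ofReal_mul (gaussWeight_nonneg k hy.1)).symm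
      · simp [hyA]
    · refine Eventually.of_forall fun y => ?_
      simpa [gaussStep] using gaussTransfer_nonneg hH h0 (le_max_left _ _)
  rw [hH', integral_sub (integrable_const _).restrict hSi.restrict]
  simp
  ring

/-- The covariance, under the Gauss measure, of a function and the indicator of a set. -/
noncomputable def gaussCov (A : Set ℝ) (H : ℝ → ℝ) : ℝ :=
  ∫ x in A, H x ∂gaussMeasure - gaussMeasure.real A * ∫ x, H x ∂gaussMeasure

theorem gaussCov_gaussStep (hH : Monotone H) (h0 : H 0 = 0) {A : Set ℝ} (hA : MeasurableSet A)
    (hinv : gaussMap ⁻¹' A = A) : gaussCov A (gaussStep H) = -gaussCov A H := by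
  have h1 := setIntegral_gaussStep hH h0 hA hinv
  have h2 := setIntegral_gaussStep hH h0 MeasurableSet.univ preimage_univ
  simp only [setIntegral_univ, probReal_univ] at h2
  rw [gaussCov, gaussCov, h1, h2]
  ring

theorem abs_gaussCov_le (hH : Monotone H) (h0 : H 0 = 0) (A : Set ℝ) : |gaussCov A H| ≤ H 1 := by
  have hae := ae_gaussMeasure_mem_Icc_of_monotone hH h0
  have hi := integrable_gaussMeasure_of_monotone hH h0
  have hA0 : 0 ≤ gaussMeasure.real A := measureReal_nonneg
  have hA1 : gaussMeasure.real A ≤ 1 := measureReal_le_one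
  have h1 : 0 ≤ ∫ x, H x ∂gaussMeasure := integral_nonneg_of_ae (hae.mono fun x hx => hx.1)
  have h2 : ∫ x, H x ∂gaussMeasure ≤ H 1 := by
    simpa using integral_mono_ae hi (integrable_const (H 1)) (hae.mono fun x hx => hx.2)
  have h3 : 0 ≤ ∫ x in A, H x ∂gaussMeasure :=
    integral_nonneg_of_ae (ae_restrict_of_ae (hae.mono fun x hx => hx.1))
  have h4 : ∫ x in A, H x ∂gaussMeasure ≤ ∫ x, H x ∂gaussMeasure :=
    setIntegral_le_integral hi (hae.mono fun x hx => hx.1)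
  rw [gaussCov, abs_le]
  constructor <;> nlinarith

theorem gaussCov_eq_zero (hH : Monotone H) (h0 : H 0 = 0) {A : Set ℝ} (hA : MeasurableSet A)
    (hinv : gaussMap ⁻¹' A = A) : gaussCov A H = 0 := by
  have hbound : ∀ n : ℕ, |gaussCov A H| ≤ H 1 * (1 / 2) ^ n := by
    intro n
    induction n generalizing H with
    | zero => simpa using abs_gaussCov_le hH h0 A
    | succ n ih =>
      have h1 := ih (monotone_gaussStep hH h0) gaussStep_zero
      rw [gaussCov_gaussStep hH h0 hA hinv, abs_neg] at h1
      refine h1.trans ((mul_le_mul_of_nonneg_right (gaussStep_one_le hH h0)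
        (by positivity)).trans_eq ?_)
      ring
  have hlim : Tendsto (fun n : ℕ => H 1 * (1 / 2 : ℝ) ^ n) atTop (nhds 0) := by
    simpa using (tendsto_pow_atTop_nhds_zero_of_lt_one (r := (1 / 2 : ℝ)) (by norm_num)
      (by norm_num)).const_mul (H 1)
  exact abs_nonpos_iff.1 (ge_of_tendsto' hlim hbound)

theorem gaussMeasure_restrict_eq_smul {A : Set ℝ} (hA : MeasurableSet A)
    (hinv : gaussMap ⁻¹' A = A) : gaussMeasure.restrict A = gaussMeasure A • gaussMeasure := by
  refine Measure.ext_of_Ici _ _ fun t => ?_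
  rw [Measure.restrict_apply measurableSet_Ici, Measure.smul_apply, smul_eq_mul]
  rcases le_or_gt t 0 with ht | ht
  · have hae : ∀ᵐ x ∂gaussMeasure, x ∈ Ici t := by
      filter_upwards [ae_gaussMeasure_mem_Ico] with x hx using ht.trans hx.1
    rw [(prob_compl_eq_zero_iff measurableSet_Ici).1 hae, mul_one]
    exact Measure.measure_inter_eq_of_ae hae
  · have hmono : Monotone ((Ici t).indicator (1 : ℝ → ℝ)) := by
      intro x y hxy
      by_cases hx : t ≤ x
      · simp [indicator, hx, hx.trans hxy]
      · simp only [indicator, mem_Ici, hx, if_false]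
        split_ifs <;> simp
    have h := gaussCov_eq_zero hmono (by simp [ht]) hA hinv
    rw [gaussCov, integral_indicator_one measurableSet_Ici,
      integral_indicator_one measurableSet_Ici, sub_eq_zero, measureReal_restrict_apply
      measurableSet_Ici, measureReal_def, measureReal_def, measureReal_def, ← ENNReal.toReal_mul] at h
    exact (ENNReal.toReal_eq_toReal_iff' (measure_ne_top _ _)
      (ENNReal.mul_ne_top (measure_ne_top _ _) (measure_ne_top _ _))).1 h

theorem ergodic_gaussMap : Ergodic gaussMap gaussMeasure := by
  refine ⟨measurePreserving_gaussMap, ⟨fun A hA hinv => ?_⟩⟩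
  have h := congrArg (fun ν : Measure ℝ => ν Aᶜ) (gaussMeasure_restrict_eq_smul hA hinv)
  simp only [Measure.restrict_apply hA.compl, compl_inter_self, measure_empty, Measure.smul_apply,
    smul_eq_mul] at h
  rw [eventuallyConst_set']
  rcases mul_eq_zero.1 h.symm with h | h
  · exact Or.inl (ae_eq_empty.2 h)
  · exact Or.inr (ae_eq_univ.2 h)

end GaussErgodic

section LogIntegral
open MeasureTheory Set

theorem hasDerivAt_pow_mul_log_primitive (n : ℕ) {x : ℝ} (hx : 0 < x) :
    HasDerivAt (fun x : ℝ => x ^ (n + 1) / (n + 1) ^ 2 - x ^ n * (x * Real.log x) / (n + 1))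
      (x ^ n * -Real.log x) x := by
  have h1 := (hasDerivAt_pow (n + 1) x).div_const (((n : ℝ) + 1) ^ 2)
  have h2 := ((hasDerivAt_pow (n + 1) x).mul (Real.hasDerivAt_log hx.ne')).div_const ((n : ℝ) + 1)
  have hn : (n : ℝ) + 1 ≠ 0 := by positivity
  refine ((h1.sub h2).congr_of_eventuallyEq (Eventually.of_forall fun y => ?_)).congr_deriv ?_
  · rw [Pi.sub_apply, Pi.mul_apply]
    ring
  · push_cast
    field_simp
    ring

theorem continuous_pow_mul_log_primitive (n : ℕ) : Continuous
    fun x : ℝ => x ^ (n + 1) / ((n : ℝ) + 1) ^ 2 - x ^ n * (x * Real.log x) / (n + 1) :=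
  ((continuous_pow _).div_const _).sub (((continuous_pow n).mul Real.continuous_mul_log).div_const _)

theorem integrableOn_pow_mul_log (n : ℕ) :
    IntegrableOn (fun x : ℝ => x ^ n * -Real.log x) (Ioc 0 1) :=
  intervalIntegral.integrableOn_deriv_of_nonneg (continuous_pow_mul_log_primitive n).continuousOn
    (fun _ hx => hasDerivAt_pow_mul_log_primitive n hx.1)
    fun _ hx => mul_nonneg (pow_nonneg hx.1.le n) (neg_nonneg.2 (Real.log_nonpos hx.1.le hx.2.le))

theorem setIntegral_pow_mul_log (n : ℕ) :
    ∫ x in Ioc (0 : ℝ) 1, x ^ n * -Real.log x = 1 / ((n : ℝ) + 1) ^ 2 := by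
  rw [← intervalIntegral.integral_of_le zero_le_one,
    intervalIntegral.integral_eq_sub_of_hasDerivAt_of_le zero_le_one
      (continuous_pow_mul_log_primitive n).continuousOn
      (fun _ hx => hasDerivAt_pow_mul_log_primitive n hx.1)
      ((intervalIntegrable_iff_integrableOn_Ioc_of_le zero_le_one).2 (integrableOn_pow_mul_log n))]
  simp

theorem hasSum_one_div_add_one_sq :
    HasSum (fun n : ℕ => 1 / ((n : ℝ) + 1) ^ 2) (Real.pi ^ 2 / 6) := by
  simpa using (hasSum_nat_add_iff' 1).2 hasSum_zeta_two

theorem tsum_neg_one_pow_div_add_one_sq :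
    ∑' n : ℕ, (-1 : ℝ) ^ n * (1 / ((n : ℝ) + 1) ^ 2) = Real.pi ^ 2 / 12 := by
  have hs := hasSum_one_div_add_one_sq
  have hodd : HasSum (fun n : ℕ => 1 / (((2 * n + 1 : ℕ) : ℝ) + 1) ^ 2) (Real.pi ^ 2 / 24) := by
    have h := hs.div_const 4
    rw [show Real.pi ^ 2 / 6 / 4 = Real.pi ^ 2 / 24 by ring] at h
    refine h.congr_fun fun n => ?_
    push_cast
    field_simp
    ring
  have heven : HasSum (fun n : ℕ => 1 / (((2 * n : ℕ) : ℝ) + 1) ^ 2) (Real.pi ^ 2 / 8) := by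
    have h1 : Summable fun n : ℕ => 1 / (((2 * n : ℕ) : ℝ) + 1) ^ 2 :=
      hs.summable.comp_injective (mul_right_injective₀ two_ne_zero)
    have h2 := (HasSum.even_add_odd (f := fun n : ℕ => 1 / ((n : ℝ) + 1) ^ 2) h1.hasSum hodd).unique
      hs
    rw [show Real.pi ^ 2 / 8 = ∑' n : ℕ, 1 / (((2 * n : ℕ) : ℝ) + 1) ^ 2 by linarith]
    exact h1.hasSum
  refine (HasSum.even_add_odd (f := fun n : ℕ => (-1 : ℝ) ^ n * (1 / ((n : ℝ) + 1) ^ 2))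
    (m := Real.pi ^ 2 / 8) (m' := -(Real.pi ^ 2 / 24)) ?_ ?_).tsum_eq.trans (by ring)
  · simpa using heven
  · simpa [pow_succ] using hodd.neg

theorem setIntegral_neg_log_div_one_add :
    ∫ x in Ioc (0 : ℝ) 1, -Real.log x / (1 + x) = Real.pi ^ 2 / 12 := by
  have hint : ∀ n : ℕ, Integrable (fun x : ℝ => (-1) ^ n * (x ^ n * -Real.log x))
      (volume.restrict (Ioc 0 1)) := fun n => (integrableOn_pow_mul_log n).const_mul _
  have hnorm : ∀ n : ℕ, ∫ x in Ioc (0 : ℝ) 1, ‖(-1) ^ n * (x ^ n * -Real.log x)‖ =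
      1 / ((n : ℝ) + 1) ^ 2 := fun n => by
    rw [← setIntegral_pow_mul_log n]
    refine setIntegral_congr_fun measurableSet_Ioc fun x hx => ?_
    have := mul_nonneg (pow_nonneg hx.1.le n) (neg_nonneg.2 (Real.log_nonpos hx.1.le hx.2))
    simp only [norm_mul, norm_pow, norm_neg, norm_one, one_pow, one_mul]
    rw [← norm_pow, ← norm_neg (Real.log x), ← norm_mul, Real.norm_of_nonneg this]
  have hsum := integral_tsum_of_summable_integral_norm hint
    (by simpa only [hnorm] using hasSum_one_div_add_one_sq.summable)
  simp_rw [integral_const_mul, setIntegral_pow_mul_log, tsum_neg_one_pow_div_add_one_sq] at hsum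
  rw [hsum, ← restrict_Ioo_eq_restrict_Ioc]
  refine setIntegral_congr_fun measurableSet_Ioo fun x hx => ?_
  have hgeo := hasSum_geometric_of_abs_lt_one (r := -x)
    (by rw [abs_neg, abs_lt]; constructor <;> linarith [hx.1, hx.2])
  have := (hgeo.mul_right (-Real.log x)).tsum_eq
  simp only [sub_neg_eq_add] at this
  rw [div_eq_inv_mul, ← this]
  exact tsum_congr fun n => by rw [neg_pow x]; ring

theorem ae_gaussDensity_lt_top (ν : Measure ℝ) :
    ∀ᵐ x ∂ν, ENNReal.ofReal (((1 + x) * Real.log 2)⁻¹) < ⊤ :=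
  Eventually.of_forall fun _ => ENNReal.ofReal_lt_top

theorem toReal_gaussDensity_smul_neg_log {x : ℝ} (hx : 0 < x) :
    (ENNReal.ofReal (((1 + x) * Real.log 2)⁻¹)).toReal • -Real.log x =
      (Real.log 2)⁻¹ * (-Real.log x / (1 + x)) := by
  have := Real.log_pos one_lt_two
  rw [ENNReal.toReal_ofReal (by positivity), smul_eq_mul]
  field_simp

theorem integral_neg_log_gaussMeasure :
    ∫ x, -Real.log x ∂gaussMeasure = Real.pi ^ 2 / (12 * Real.log 2) := by
  rw [gaussMeasure, integral_withDensity_eq_integral_toReal_smul measurable_gaussDensity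
    (ae_gaussDensity_lt_top _), ← restrict_Ioo_eq_restrict_Ico, restrict_Ioo_eq_restrict_Ioc,
    setIntegral_congr_fun measurableSet_Ioc fun x hx => toReal_gaussDensity_smul_neg_log hx.1,
    integral_const_mul, setIntegral_neg_log_div_one_add]
  ring

theorem integrable_neg_log_gaussMeasure : Integrable (fun x => -Real.log x) gaussMeasure := by
  have hlog := Real.log_pos one_lt_two
  by_contra h
  have h0 := integral_neg_log_gaussMeasure
  rw [integral_undef h] at h0
  exact absurd h0 (by positivity)

end LogIntegral

section KhinchinLevy
open MeasureTheory Set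

variable {x : ℝ}

theorem partialQuotient_pos (hx : ∀ k, gaussMap^[k] (Int.fract x) ∈ Ioo (0 : ℝ) 1) (n : ℕ) :
    1 ≤ partialQuotient x n :=
  Int.le_floor.2 (by simpa using (one_le_inv₀ (hx n).1).2 (hx n).2.le)

theorem convDenom_pos (hx : ∀ k, gaussMap^[k] (Int.fract x) ∈ Ioo (0 : ℝ) 1) (n : ℕ) :
    1 ≤ convDenom x n ∧ convDenom x n ≤ convDenom x (n + 1) := by
  induction n with
  | zero => exact ⟨le_rfl, partialQuotient_pos hx 0⟩
  | succ n ih =>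
    refine ⟨ih.1.trans ih.2, ?_⟩
    have h := partialQuotient_pos hx (n + 1)
    simp only [convDenom]
    nlinarith [ih.1, ih.2]

theorem inv_iterate_gaussMap (x : ℝ) (n : ℕ) :
    (gaussMap^[n] (Int.fract x))⁻¹ = partialQuotient x n + gaussMap^[n + 1] (Int.fract x) := by
  rw [Function.iterate_succ_apply', gaussMap, partialQuotient, Int.floor_add_fract]

/-- The product of the first `n + 1` iterates of the Gauss map is the reciprocal of
`q_{n+1} + q_n T^{n+1} x`. -/
theorem log_convDenom_add_eq_birkhoffSum
    (hx : ∀ k, gaussMap^[k] (Int.fract x) ∈ Ioo (0 : ℝ) 1) (n : ℕ) :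
    Real.log (convDenom x (n + 1) + convDenom x n * gaussMap^[n + 1] (Int.fract x)) =
      birkhoffSum gaussMap (fun y => -Real.log y) (n + 1) (Int.fract x) := by
  induction n with
  | zero =>
    have h := inv_iterate_gaussMap x 0
    simp only [convDenom, zero_add, Int.cast_one, one_mul, birkhoffSum_one]
    rw [← h, Real.log_inv, Function.iterate_zero_apply]
  | succ n ih =>
    have hpos := (hx (n + 1)).1
    have h := inv_iterate_gaussMap x (n + 1)
    have hq : (0 : ℝ) < convDenom x (n + 1) := by
      exact_mod_cast (convDenom_pos hx (n + 1)).1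
    have hq' : (0 : ℝ) < convDenom x n := by exact_mod_cast (convDenom_pos hx n).1
    rw [birkhoffSum_succ, ← ih, ← Real.log_inv, ← Real.log_mul (by positivity) (by positivity)]
    congr 1
    simp only [convDenom]
    push_cast
    rw [add_mul, mul_assoc, mul_inv_cancel₀ hpos.ne', h]
    ring

theorem abs_log_convDenom_sub_birkhoffSum_le
    (hx : ∀ k, gaussMap^[k] (Int.fract x) ∈ Ioo (0 : ℝ) 1) (n : ℕ) :
    |Real.log (convDenom x n) - birkhoffSum gaussMap (fun y => -Real.log y) n (Int.fract x)| ≤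
      Real.log 2 := by
  cases n with
  | zero => simpa [convDenom] using Real.log_nonneg one_le_two
  | succ n =>
    have hpos := (hx (n + 1)).1
    have hlt := (hx (n + 1)).2
    have hq : (0 : ℝ) < convDenom x n := by exact_mod_cast (convDenom_pos hx n).1
    have hle : (convDenom x n : ℝ) ≤ convDenom x (n + 1) := by
      exact_mod_cast (convDenom_pos hx n).2
    have hq' := hq.trans_le hle
    rw [← log_convDenom_add_eq_birkhoffSum hx n]
    have h1 : Real.log (convDenom x (n + 1)) ≤ Real.log (convDenom x (n + 1) +
        convDenom x n * gaussMap^[n + 1] (Int.fract x)) :=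
      Real.log_le_log hq' (le_add_of_nonneg_right (by positivity))
    have h2 : Real.log (convDenom x (n + 1) +
        convDenom x n * gaussMap^[n + 1] (Int.fract x)) ≤ Real.log (2 * convDenom x (n + 1)) :=
      Real.log_le_log (by positivity) (by nlinarith)
    rw [Real.log_mul two_ne_zero hq'.ne'] at h2
    rw [abs_le]
    constructor <;> linarith [Real.log_nonneg one_le_two]

theorem tendsto_convDenom_rpow {L : ℝ}
    (hx : ∀ k, gaussMap^[k] (Int.fract x) ∈ Ioo (0 : ℝ) 1)
    (hL : Tendsto (fun n : ℕ =>
      birkhoffSum gaussMap (fun y => -Real.log y) n (Int.fract x) / n) atTop (nhds L)) :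
    Tendsto (fun n : ℕ => (convDenom x n : ℝ) ^ ((n : ℝ)⁻¹)) atTop (nhds (Real.exp L)) := by
  have hdiff : Tendsto (fun n : ℕ => (Real.log (convDenom x n) -
      birkhoffSum gaussMap (fun y => -Real.log y) n (Int.fract x)) / n) atTop (nhds 0) := by
    refine squeeze_zero_norm (fun n => ?_) (tendsto_const_div_atTop_nhds_zero_nat (Real.log 2))
    rw [norm_div, Real.norm_natCast, Real.norm_eq_abs]
    exact div_le_div_of_nonneg_right (abs_log_convDenom_sub_birkhoffSum_le hx n) n.cast_nonneg
  have hlog : Tendsto (fun n : ℕ => Real.log (convDenom x n) / n) atTop (nhds L) := by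
    simpa [← add_div] using hL.add hdiff
  refine ((Real.continuous_exp.tendsto L).comp hlog).congr fun n => ?_
  have hq : (0 : ℝ) < convDenom x n := by exact_mod_cast (convDenom_pos hx n).1
  rw [Function.comp_apply, Real.rpow_def_of_pos hq, div_eq_mul_inv]

theorem ae_gaussMeasure_mem_Ioo : ∀ᵐ x ∂gaussMeasure, x ∈ Ioo (0 : ℝ) 1 := by
  have h := ae_restrict_mem (μ := volume) (measurableSet_Ioo (a := (0 : ℝ)) (b := 1))
  rw [restrict_Ioo_eq_restrict_Ico] at h
  exact (withDensity_absolutelyContinuous _ _).ae_le h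

theorem ae_restrict_of_ae_gaussMeasure {p : ℝ → Prop} (h : ∀ᵐ x ∂gaussMeasure, p x) :
    ∀ᵐ x ∂volume.restrict (Ico (0 : ℝ) 1), p x := by
  rw [gaussMeasure, ae_withDensity_iff measurable_gaussDensity] at h
  filter_upwards [h, ae_restrict_mem measurableSet_Ico] with x hx hmem
  have := hmem.1
  have := Real.log_pos one_lt_two
  exact hx (ENNReal.ofReal_pos.2 (by positivity)).ne'

theorem ae_fract_of_ae_restrict_Ico {p : ℝ → Prop}
    (h : ∀ᵐ x ∂volume.restrict (Ico (0 : ℝ) 1), p x) : ∀ᵐ x : ℝ, p (Int.fract x) := by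
  rw [ae_restrict_iff' measurableSet_Ico] at h
  have hshift : ∀ᵐ x : ℝ, ∀ m : ℤ, x - m ∈ Ico (0 : ℝ) 1 → p (x - m) :=
    ae_all_iff.2 fun m => (measurePreserving_sub_right volume (m : ℝ)).quasiMeasurePreserving.ae h
  filter_upwards [hshift] with x hx
  exact hx ⌊x⌋ ⟨Int.fract_nonneg x, Int.fract_lt_one x⟩

end KhinchinLevy

/-- **Khinchin–Lévy theorem**: for Lebesgue-almost every real `x`, the denominators
`q_n(x)` of the convergents of the continued fraction of `x` satisfy
`lim_{n→∞} (q_n(x))^{1/n} = e^{π²/(12 log 2)}`, the Khinchin–Lévy constant. -/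
theorem khinchin_levy_theorem :
    ∀ᵐ x : ℝ, Tendsto (fun n : ℕ => (convDenom x n : ℝ) ^ ((n : ℝ)⁻¹)) atTop
      (nhds (Real.exp (Real.pi ^ 2 / (12 * Real.log 2)))) := by
  have hlim := ergodic_gaussMap.ae_tendsto_birkhoffSum_div integrable_neg_log_gaussMeasure
    Real.measurable_log.neg
  rw [integral_neg_log_gaussMeasure] at hlim
  have hmem : ∀ᵐ x ∂gaussMeasure, ∀ k, gaussMap^[k] x ∈ Set.Ioo (0 : ℝ) 1 :=
    MeasureTheory.ae_all_iff.2 fun k =>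
      (measurePreserving_gaussMap.iterate k).quasiMeasurePreserving.ae ae_gaussMeasure_mem_Ioo
  filter_upwards [ae_fract_of_ae_restrict_Ico (ae_restrict_of_ae_gaussMeasure (hmem.and hlim))]
    with x hx
  exact tendsto_convDenom_rpow hx.1 hx.2
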